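/- 384/(π√3) = ∑_{n=0}^∞ (1/16^n) · [(1/2)_n (5/6)_n² (5/12)_n (11/12)_n / ((1)_n³ (2/3)_n (5/3)_n)] · (1080n² + 798n + 55). -/

import Mathlib

open Real

/-- Pochhammer symbol (x)_n = x (x+1) ⋯ (x+n-1). -/
noncomputable def poch (x : ℝ) (n : ℕ) : ℝ :=
  ∏ k ∈ Finset.range n, (x + k)

lemma poch_zero (x : ℝ) : poch x 0 = 1 := by simp [poch]

lemma poch_succ (x : ℝ) (n : ℕ) : poch x (n+1) = poch x n * (x + n) := by
  simp [poch, Finset.prod_range_succ]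

lemma poch_pos {x : ℝ} (hx : 0 < x) (n : ℕ) : 0 < poch x n :=
  Finset.prod_pos fun k _ => by positivity

lemma poch_mono {x y : ℝ} (hx : 0 < x) (h : x ≤ y) (n : ℕ) : poch x n ≤ poch y n :=
  Finset.prod_le_prod (fun k _ => by positivity) fun k _ => by linarith

lemma poch_super {x : ℝ} (hx : 0 < x) (n k : ℕ) : poch x n * poch x k ≤ poch x (n+k) := by
  induction k with
  | zero => simp [poch_zero]
  | succ k ih =>
    rw [← add_assoc, poch_succ, poch_succ, ← mul_assoc]
    have := poch_pos hx n
    have := poch_pos hx k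
    have := poch_pos hx (n+k)
    push_cast
    gcongr
    have : (0:ℝ) ≤ n := by positivity
    linarith

lemma poch_double (x : ℝ) (n : ℕ) :
    poch x (2*n) = 4^n * poch (x/2) n * poch ((x+1)/2) n := by
  induction n with
  | zero => simp [poch_zero]
  | succ n ih =>
    rw [show 2*(n+1) = 2*n+1+1 by ring, poch_succ, poch_succ, ih, poch_succ, poch_succ]
    push_cast
    ring

/-- first pair -/
noncomputable def V (n k : ℕ) : ℝ :=
  poch (1/6) (n+k) * poch (1/2) (n+k) * poch (1/6) k ^ 2 /
    (poch 1 (n+k) * poch (2/3) (n+k) * poch 1 (2*n+k) ^ 2) *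
  (poch (5/6) n ^ 2 * poch (1/2) n ^ 2 * poch (5/6) (2*n) / poch (1/3) (2*n))

noncomputable def Q (n k : ℝ) : ℝ :=
  (55/864 + 337/216*n + 1325/108*n^2 + 359/9*n^3 + 343/6*n^4 + 30*n^5)
  + (13/12 + 83/6*n + 179/3*n^2 + 314/3*n^3 + 64*n^4) * k
  + (23/8 + 74/3*n + 125/2*n^2 + 48*n^3) * k^2
  + (10/3 + 47/3*n + 16*n^2) * k^3
  + (4/3 + 2*n) * k^4

noncomputable def F (n k : ℕ) : ℝ := V n k * (1/6 + 2*n + 2*k)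

noncomputable def G (n k : ℕ) : ℝ :=
  V n k * (Q n k / ((2*n+1+k)^2 * (1/3+2*n) * (4/3+2*n)))

lemma V_pos (n k : ℕ) : 0 < V n k := by
  have h : ∀ x : ℝ, 0 < x → ∀ n, 0 < poch x n := fun x hx n => poch_pos hx n
  have h1 := h (1/6) (by norm_num)
  have h2 := h (1/2) (by norm_num)
  have h3 := h 1 (by norm_num)
  have h4 := h (2/3) (by norm_num)
  have h5 := h (5/6) (by norm_num)
  have h6 := h (1/3) (by norm_num)
  unfold V
  have := h1 (n+k); have := h2 (n+k); have := h1 k; have := h3 (n+k); have := h4 (n+k)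
  have := h3 (2*n+k); have := h5 n; have := h2 n; have := h5 (2*n); have := h6 (2*n)
  positivity

lemma V_succ_k (n k : ℕ) : V n (k+1) = V n k * ((1/6+n+k) * (1/2+n+k) * (1/6+k)^2 /
    ((1+n+k) * (2/3+n+k) * (2*n+k+1)^2)) := by
  unfold V
  rw [← add_assoc, ← add_assoc]
  simp only [poch_succ]
  push_cast
  have : (1:ℝ)+n+k ≠ 0 := by positivity
  have : (2/3:ℝ)+n+k ≠ 0 := by positivity
  have : (2:ℝ)*n+k+1 ≠ 0 := by positivity
  have h : ∀ x : ℝ, 0 < x → ∀ n, poch x n ≠ 0 := fun x hx n => (poch_pos hx n).ne'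
  have h1 := h 1 one_pos (n+k)
  have h2 := h (2/3) (by norm_num) (n+k)
  have h3 := h 1 one_pos (2*n+k)
  have h4 := h (1/3) (by norm_num) (2*n)
  generalize poch 1 (n+k) = x1 at *
  generalize poch (2/3) (n+k) = x2 at *
  generalize poch 1 (2*n+k) = x3 at *
  generalize poch (1/3) (2*n) = x4 at *
  rw [show (1:ℝ) + (n+k) = 1+n+k by ring, show (2/3:ℝ) + (n+k) = 2/3+n+k by ring,
    show (1:ℝ)+(2*n+k) = 2*n+k+1 by ring]
  field_simp
  ring

lemma V_succ_n (n k : ℕ) : V (n+1) k = V n k * ((1/6+n+k) * (1/2+n+k) /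
    ((1+n+k) * (2/3+n+k) * (2*n+k+1)^2 * (2*n+k+2)^2) *
    ((5/6+n)^2*(1/2+n)^2*(5/6+2*n)*(11/6+2*n)/((1/3+2*n)*(4/3+2*n)))) := by
  unfold V
  rw [show n+1+k = n+k+1 by ring, show 2*(n+1)+k = 2*n+k+1+1 by ring,
    show 2*(n+1) = 2*n+1+1 by ring]
  simp only [poch_succ]
  push_cast
  have : (1:ℝ)+n+k ≠ 0 := by positivity
  have : (2/3:ℝ)+n+k ≠ 0 := by positivity
  have : (2:ℝ)*n+k+1 ≠ 0 := by positivity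
  have : (2:ℝ)*n+k+2 ≠ 0 := by positivity
  have : (1/3:ℝ)+2*n ≠ 0 := by positivity
  have : (4/3:ℝ)+2*n ≠ 0 := by positivity
  have h : ∀ x : ℝ, 0 < x → ∀ n, poch x n ≠ 0 := fun x hx n => (poch_pos hx n).ne'
  have h1 := h 1 one_pos (n+k)
  have h2 := h (2/3) (by norm_num) (n+k)
  have h3 := h 1 one_pos (2*n+k)
  have h4 := h (1/3) (by norm_num) (2*n)
  generalize poch 1 (n+k) = x1 at *
  generalize poch (2/3) (n+k) = x2 at *
  generalize poch 1 (2*n+k) = x3 at *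
  generalize poch (1/3) (2*n) = x4 at *
  rw [show (1:ℝ) + (n+k) = 1+n+k by ring, show (2/3:ℝ) + (n+k) = 2/3+n+k by ring,
    show (1:ℝ)+(2*n+k+1) = 2*n+k+2 by ring, show (1:ℝ)+(2*n+k) = 2*n+k+1 by ring,
    show (1/3:ℝ)+(2*n+1) = 4/3+2*n by ring]
  generalize (1:ℝ)+n+k = y1 at *
  generalize (2/3:ℝ)+n+k = y2 at *
  generalize (2:ℝ)*n+k+1 = y3 at *
  generalize (2:ℝ)*n+k+2 = y4 at *
  generalize (1/3:ℝ)+2*n = y5 at *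
  generalize (4/3:ℝ)+2*n = y6 at *
  field_simp
  ring

set_option maxHeartbeats 1000000 in
lemma wz1 (n k : ℕ) : F (n+1) k - F n k = G n (k+1) - G n k := by
  unfold F G
  rw [V_succ_k, V_succ_n]
  generalize V n k = v
  unfold Q
  push_cast
  have hn : (0:ℝ) ≤ n := by positivity
  have hk : (0:ℝ) ≤ k := by positivity
  generalize (n:ℝ) = n at *
  generalize (k:ℝ) = k at *
  have : 1+n+k ≠ 0 := by positivity
  have : 2/3+n+k ≠ 0 := by positivity
  have : 2*n+k+1 ≠ 0 := by positivity
  have : 2*n+k+2 ≠ 0 := by positivity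
  have : 1/3+2*n ≠ 0 := by positivity
  have : 4/3+2*n ≠ 0 := by positivity
  rw [show 2*n+1+k = 2*n+k+1 by ring, show 2*n+1+(k+1) = 2*n+k+2 by ring]
  rw [mul_assoc, mul_assoc v, ← mul_sub, ← mul_sub]
  congr 1
  field_simp
  ring

lemma F_half (n k : ℕ) : F (n+1) k ≤ 1/2 * F n k := by
  unfold F
  rw [V_succ_n]
  have hv := V_pos n k
  generalize V n k = v at *
  push_cast
  have hn : (0:ℝ) ≤ n := by positivity
  have hk : (0:ℝ) ≤ k := by positivity
  generalize (n:ℝ) = n at *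
  generalize (k:ℝ) = k at *
  rw [mul_assoc, mul_left_comm (1/2)]
  apply mul_le_mul_of_nonneg_left _ hv.le
  rw [div_mul_div_comm, div_mul_eq_mul_div, div_le_iff₀ (by positivity), ← sub_nonneg]
  ring_nf
  positivity

/-- second pair -/
noncomputable def U (n k : ℕ) : ℝ :=
  poch (1/6) (n+k) * poch (1/2) k * poch (1/6) k ^ 2 /
    (poch 1 k * poch (2/3) (n+k) * poch 1 (n+k) ^ 2) *
  (poch (1/2) n ^ 2 * poch (5/6) n / poch (1/3) n)

noncomputable def Fb (n k : ℕ) : ℝ := U n k * (1/6 + n + 2*k)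

noncomputable def Gb (n k : ℕ) : ℝ := U n k * (k * (1/2+2*n+k) / (1/3+n))

lemma U_pos (n k : ℕ) : 0 < U n k := by
  have h : ∀ x : ℝ, 0 < x → ∀ n, 0 < poch x n := fun x hx n => poch_pos hx n
  have h1 := h (1/6) (by norm_num)
  have h2 := h (1/2) (by norm_num)
  have h3 := h 1 (by norm_num)
  have h4 := h (2/3) (by norm_num)
  have h5 := h (5/6) (by norm_num)
  have h6 := h (1/3) (by norm_num)
  unfold U
  have := h1 (n+k); have := h2 k; have := h1 k; have := h3 (n+k); have := h4 (n+k)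
  have := h3 k; have := h5 n; have := h2 n; have := h6 n
  positivity

lemma U_succ_k (n k : ℕ) : U n (k+1) = U n k * ((1/6+n+k) * (1/2+k) * (1/6+k)^2 /
    ((1+k) * (2/3+n+k) * (1+n+k)^2)) := by
  unfold U
  rw [← add_assoc]
  simp only [poch_succ]
  push_cast
  have : (1:ℝ)+n+k ≠ 0 := by positivity
  have : (1:ℝ)+k ≠ 0 := by positivity
  have : (2/3:ℝ)+n+k ≠ 0 := by positivity
  have h : ∀ x : ℝ, 0 < x → ∀ n, poch x n ≠ 0 := fun x hx n => (poch_pos hx n).ne'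
  have h1 := h 1 one_pos (n+k)
  have h2 := h (2/3) (by norm_num) (n+k)
  have h3 := h 1 one_pos k
  have h4 := h (1/3) (by norm_num) n
  generalize poch 1 (n+k) = x1 at *
  generalize poch (2/3) (n+k) = x2 at *
  generalize poch 1 k = x3 at *
  generalize poch (1/3) n = x4 at *
  rw [show (1:ℝ) + (n+k) = 1+n+k by ring, show (2/3:ℝ) + (n+k) = 2/3+n+k by ring]
  field_simp
  ring

lemma U_succ_n (n k : ℕ) : U (n+1) k = U n k * ((1/6+n+k) /
    ((2/3+n+k) * (1+n+k)^2) * ((1/2+n)^2*(5/6+n)/(1/3+n))) := by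
  unfold U
  rw [show n+1+k = n+k+1 by ring]
  simp only [poch_succ]
  push_cast
  have : (1:ℝ)+n+k ≠ 0 := by positivity
  have : (1/3:ℝ)+n ≠ 0 := by positivity
  have : (2/3:ℝ)+n+k ≠ 0 := by positivity
  have h : ∀ x : ℝ, 0 < x → ∀ n, poch x n ≠ 0 := fun x hx n => (poch_pos hx n).ne'
  have h1 := h 1 one_pos (n+k)
  have h2 := h (2/3) (by norm_num) (n+k)
  have h3 := h 1 one_pos k
  have h4 := h (1/3) (by norm_num) n
  generalize poch 1 (n+k) = x1 at *
  generalize poch (2/3) (n+k) = x2 at *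
  generalize poch 1 k = x3 at *
  generalize poch (1/3) n = x4 at *
  rw [show (1:ℝ) + (n+k) = 1+n+k by ring, show (2/3:ℝ) + (n+k) = 2/3+n+k by ring]
  field_simp
  ring

lemma wz2 (n k : ℕ) : Fb (n+1) k - Fb n k = Gb n (k+1) - Gb n k := by
  unfold Fb Gb
  rw [U_succ_k, U_succ_n]
  generalize U n k = v
  push_cast
  have hn : (0:ℝ) ≤ n := by positivity
  have hk : (0:ℝ) ≤ k := by positivity
  generalize (n:ℝ) = n at *
  generalize (k:ℝ) = k at *
  have : 1+n+k ≠ 0 := by positivity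
  have : 1+k ≠ 0 := by positivity
  have : 2/3+n+k ≠ 0 := by positivity
  have : 1/3+n ≠ 0 := by positivity
  rw [mul_assoc, mul_assoc v, ← mul_sub, ← mul_sub]
  congr 1
  field_simp
  ring

lemma Fb_zero (k : ℕ) : Fb 0 k = F 0 k := by
  have h3 := (poch_pos one_pos k).ne'
  have h2 := (poch_pos (x := 2/3) (by norm_num) k).ne'
  simp only [F, Fb, U, V, mul_zero, zero_add, poch_zero, Nat.cast_zero, add_zero]
  field_simp

noncomputable def pr (k : ℕ) : ℝ := poch (1/6) k / poch 1 k

lemma pr_pos (k : ℕ) : 0 < pr k := div_pos (poch_pos (by norm_num) k) (poch_pos one_pos k)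

lemma pr_succ (k : ℕ) : pr (k+1) = pr k * ((1/6+k)/(1+k)) := by
  unfold pr
  rw [poch_succ, poch_succ, mul_div_mul_comm]

lemma pr_anti : Antitone pr := by
  apply antitone_nat_of_succ_le
  intro k
  rw [pr_succ]
  apply mul_le_of_le_one_right (pr_pos k).le
  rw [div_le_one (by positivity)]
  linarith

lemma pr_bound (k : ℕ) : pr k ^ 4 * (k+1)^3 ≤ 1 := by
  induction k with
  | zero => simp [pr, poch_zero]
  | succ k ih =>
    rw [pr_succ]
    push_cast
    have hk : (0:ℝ) ≤ k := by positivity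
    have : ((1/6+k)/(1+k))^4 * ((k:ℝ)+1+1)^3 ≤ (k+1)^3 := by
      rw [div_pow, div_mul_eq_mul_div, div_le_iff₀ (by positivity), ← sub_nonneg]
      ring_nf
      positivity
    calc _ = pr k ^ 4 * (((1/6+k)/(1+k))^4 * ((k:ℝ)+1+1)^3) := by ring
      _ ≤ pr k ^ 4 * (k+1)^3 := by gcongr
      _ ≤ 1 := ih

noncomputable def ww (k : ℕ) : ℝ := (k+1)^2 * pr k ^ 3

lemma ww_tendsto : Filter.Tendsto ww Filter.atTop (nhds 0) := by
  have h4 : Filter.Tendsto (fun k => ww k ^ 4) Filter.atTop (nhds 0) := by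
    apply squeeze_zero (fun k => by positivity) _ tendsto_one_div_add_atTop_nhds_zero_nat
    intro k
    have h := pr_bound k
    have hp := pr_pos k
    rw [le_div_iff₀ (by positivity)]
    calc _ = (pr k ^ 4 * (k+1)^3)^3 := by unfold ww; ring
      _ ≤ 1 := pow_le_one₀ (by positivity) h
  have := (Real.continuous_sqrt.tendsto 0).comp ((Real.continuous_sqrt.tendsto' 0 0 (by simp)).comp h4)
  simp only [Real.sqrt_zero] at this
  refine this.congr fun k => ?_
  have hw : 0 ≤ ww k := by have := pr_pos k; unfold ww; positivity
  simp only [Function.comp]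
  rw [show ww k ^ 4 = (ww k ^ 2)^2 by ring, Real.sqrt_sq (by positivity), Real.sqrt_sq hw]

lemma poch_add_ge_one (n k : ℕ) : poch 1 k ≤ poch 1 (n+k) := by
  induction n with
  | zero => simp
  | succ n ih =>
    rw [show n+1+k = n+k+1 by ring, poch_succ]
    refine ih.trans (le_mul_of_one_le_right (poch_pos one_pos _).le ?_)
    have : (0:ℝ) ≤ (n+k : ℕ) := by positivity
    linarith

lemma pr_mid (n k : ℕ) : poch (1/6) k / poch 1 (n+k) ≤ pr k :=
  div_le_div_of_nonneg_left (poch_pos (by norm_num) k).le (poch_pos one_pos k) (poch_add_ge_one n k)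

lemma V_le (n k : ℕ) : V n k ≤
    pr k ^ 3 * (poch (5/6) n ^ 2 * poch (1/2) n ^ 2 * poch (5/6) (2*n) / poch (1/3) (2*n)) := by
  unfold V
  have h5 := poch_pos (x := 5/6) (by norm_num) n
  have h2 := poch_pos (x := 1/2) (by norm_num) n
  have h55 := poch_pos (x := 5/6) (by norm_num) (2*n)
  have h3 := poch_pos (x := 1/3) (by norm_num) (2*n)
  apply mul_le_mul_of_nonneg_right _ (by positivity)
  have e1 : pr (n+k) ≤ pr k := pr_anti (by omega)
  have e2 : poch (1/2) (n+k) / poch (2/3) (n+k) ≤ 1 := by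
    rw [div_le_one (poch_pos (by norm_num) _)]
    exact poch_mono (by norm_num) (by norm_num) _
  have e3 := pr_mid (2*n) k
  have p1 := pr_pos k
  have p2 := pr_pos (n+k)
  have p3 : 0 < poch (1/6) k / poch 1 (2*n+k) :=
    div_pos (poch_pos (by norm_num) _) (poch_pos one_pos _)
  have p4 : 0 < poch (1/2) (n+k) / poch (2/3) (n+k) :=
    div_pos (poch_pos (by norm_num) _) (poch_pos (by norm_num) _)
  calc _ = pr (n+k) * (poch (1/2) (n+k) / poch (2/3) (n+k)) *
        (poch (1/6) k / poch 1 (2*n+k)) ^ 2 := by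
        unfold pr
        rw [div_mul_div_comm, div_pow, div_mul_div_comm]
    _ ≤ pr k * 1 * pr k ^ 2 := by gcongr
    _ = _ := by ring

lemma U_le (n k : ℕ) : U n k ≤
    pr k ^ 3 * (1 / poch (2/3) n * (poch (1/2) n ^ 2 * poch (5/6) n / poch (1/3) n)) := by
  unfold U
  have h5 := poch_pos (x := 5/6) (by norm_num) n
  have h2 := poch_pos (x := 1/2) (by norm_num) n
  have h3 := poch_pos (x := 1/3) (by norm_num) n
  have h4 := poch_pos (x := 2/3) (by norm_num) n
  have h4k := poch_pos (x := 2/3) (by norm_num) (n+k)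
  have h2k := poch_pos (x := 1/2) (by norm_num) k
  rw [← mul_assoc]
  apply mul_le_mul_of_nonneg_right _ (by positivity)
  have e1 : pr (n+k) ≤ pr k := pr_anti (by omega)
  have e2 : poch (1/2) k / poch (2/3) (n+k) ≤ 1 / poch (2/3) n := by
    rw [div_le_div_iff₀ h4k h4, one_mul, mul_comm]
    refine le_trans ?_ (poch_super (by norm_num) n k)
    exact mul_le_mul_of_nonneg_left (poch_mono (by norm_num) (by norm_num) _) h4.le
  have e3 := pr_mid n k
  have p1 := pr_pos k
  have p2 := pr_pos (n+k)
  have p3 : 0 < poch (1/6) k / poch 1 (n+k) :=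
    div_pos (poch_pos (by norm_num) _) (poch_pos one_pos _)
  calc _ = pr (n+k) * (poch (1/2) k / poch (2/3) (n+k)) *
        (pr k * (poch (1/6) k / poch 1 (n+k))) := by
        unfold pr
        rw [div_mul_div_comm, div_mul_div_comm, div_mul_div_comm]
        congr 1 <;> ring
    _ ≤ pr k * (1 / poch (2/3) n) * (pr k * pr k) := by gcongr
    _ = _ := by ring

lemma G_tendsto (n : ℕ) : Filter.Tendsto (G n) Filter.atTop (nhds 0) := by
  have hQ : ∀ k : ℕ, Q n k / ((2*n+1+k)^2 * (1/3+2*n) * (4/3+2*n)) ≤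
      (k+1)^2 * (Q n 1 / ((1/3+2*n) * (4/3+2*n))) := by
    intro k
    rw [mul_div_assoc', div_le_div_iff₀ (by positivity) (by positivity)]
    have h1 : Q n k ≤ (k+1)^4 * Q n 1 := by
      unfold Q
      have hn : (0:ℝ) ≤ n := by positivity
      have hk : (0:ℝ) ≤ k := by positivity
      rw [← sub_nonneg]
      ring_nf
      positivity
    have h2 : ((k:ℝ)+1)^2 ≤ (2*n+1+k)^2 := by
      apply pow_le_pow_left₀ (by positivity)
      have hn : (0:ℝ) ≤ n := by positivity
      linarith
    have h3 : 0 ≤ Q n 1 := by unfold Q; positivity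
    calc _ ≤ (k+1)^4 * Q n 1 * ((1/3+2*n) * (4/3+2*n)) := by gcongr
      _ = (k+1)^2 * Q n 1 * ((k+1)^2 * (1/3+2*n) * (4/3+2*n)) := by ring
      _ ≤ _ := by gcongr
  have hz : ∀ k : ℕ, 0 ≤ Q n k / ((2*n+1+k)^2 * (1/3+2*n) * (4/3+2*n)) := by
    intro k; unfold Q; positivity
  have := ww_tendsto.mul_const
    ((poch (5/6) n ^ 2 * poch (1/2) n ^ 2 * poch (5/6) (2*n) / poch (1/3) (2*n)) *
      (Q n 1 / ((1/3+2*n) * (4/3+2*n))))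
  rw [zero_mul] at this
  refine squeeze_zero (fun k => mul_nonneg (V_pos n k).le (hz k)) (fun k => ?_) this
  refine (mul_le_mul (V_le n k) (hQ k) (hz k) ((V_pos n k).le.trans (V_le n k))).trans (le_of_eq ?_)
  unfold ww; ring

lemma Gb_tendsto (n : ℕ) : Filter.Tendsto (Gb n) Filter.atTop (nhds 0) := by
  have hQ : ∀ k : ℕ, (k:ℝ) * (1/2+2*n+k) / (1/3+n) ≤ (k+1)^2 * ((1+2*n) / (1/3+n)) := by
    intro k
    rw [mul_div_assoc']
    apply div_le_div_of_nonneg_right _ (by positivity)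
    have hn : (0:ℝ) ≤ n := by positivity
    have hk : (0:ℝ) ≤ k := by positivity
    rw [← sub_nonneg]
    ring_nf
    positivity
  have hz : ∀ k : ℕ, 0 ≤ (k:ℝ) * (1/2+2*n+k) / (1/3+n) := by
    intro k; positivity
  have := ww_tendsto.mul_const
    ((1 / poch (2/3) n * (poch (1/2) n ^ 2 * poch (5/6) n / poch (1/3) n)) *
      ((1+2*n) / (1/3+n)))
  rw [zero_mul] at this
  refine squeeze_zero (fun k => mul_nonneg (U_pos n k).le (hz k)) (fun k => ?_) this
  refine (mul_le_mul (U_le n k) (hQ k) (hz k) ((U_pos n k).le.trans (U_le n k))).trans (le_of_eq ?_)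
  unfold ww; ring

open Filter Topology

lemma sum_wz (f fb g : ℕ → ℝ) (h : ∀ k, fb k - f k = g (k+1) - g k) (K : ℕ) :
    ∑ k ∈ Finset.range K, fb k = ∑ k ∈ Finset.range K, f k + (g K - g 0) := by
  induction K with
  | zero => simp
  | succ K ih => rw [Finset.sum_range_succ, Finset.sum_range_succ, ih]; linarith [h K]

lemma Gb_zero (n : ℕ) : Gb n 0 = 0 := by simp [Gb]

lemma Fb_pos (n k : ℕ) : 0 < Fb n k := mul_pos (U_pos n k) (by positivity)

lemma F_pos (n k : ℕ) : 0 < F n k := mul_pos (V_pos n k) (by positivity)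

lemma Fb_part_mono (N K : ℕ) :
    ∑ k ∈ Finset.range K, Fb 0 k ≤ ∑ k ∈ Finset.range K, Fb N k := by
  induction N with
  | zero => rfl
  | succ N ih =>
    refine ih.trans ?_
    rw [sum_wz (Fb N) (Fb (N+1)) (Gb N) (wz2 N), Gb_zero]
    have : 0 ≤ Gb N K := mul_nonneg (U_pos N K).le (by positivity)
    linarith

lemma Fb_sum_const {S : ℝ} (h0 : HasSum (Fb 0) S) (N : ℕ) : HasSum (Fb N) S := by
  induction N with
  | zero => exact h0
  | succ N ih =>
    rw [hasSum_iff_tendsto_nat_of_nonneg (fun k => (Fb_pos _ k).le)] at ih ⊢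
    have := ih.add (Gb_tendsto N)
    rw [add_zero] at this
    refine this.congr fun K => ?_
    rw [sum_wz (Fb N) (Fb (N+1)) (Gb N) (wz2 N), Gb_zero, sub_zero]

lemma Fb_ratio (n k : ℕ) : Fb n (k+1) ≤ Fb n k * (13 * (k+1) * (1/((n:ℝ)+1))) := by
  unfold Fb
  rw [U_succ_k, mul_assoc, mul_assoc (U n k)]
  apply mul_le_mul_of_nonneg_left _ (U_pos n k).le
  push_cast
  have hn : (0:ℝ) ≤ n := by positivity
  have hk : (0:ℝ) ≤ k := by positivity
  generalize (n:ℝ) = n at *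
  generalize (k:ℝ) = k at *
  rw [mul_one_div, mul_div_assoc', div_mul_eq_mul_div, div_le_div_iff₀ (by positivity) (by positivity),
    ← sub_nonneg]
  ring_nf
  positivity

noncomputable def LL : ℝ := 1 / (π * Real.sqrt 3)

lemma U_zero_succ (n : ℕ) (hn : n ≠ 0) : U (n+1) 0 * n = Real.GammaSeq (2/3) n * Real.GammaSeq 1 n ^ 2 *
    Real.GammaSeq (1/3) n / (Real.GammaSeq (1/6) n * Real.GammaSeq (1/2) n ^ 2 *
      Real.GammaSeq (5/6) n) := by
  have hn' : (0:ℝ) < n := by positivity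
  have hp : ∀ x : ℝ, 0 < x → ∏ j ∈ Finset.range (n+1), (x + j) ≠ 0 :=
    fun x hx => (poch_pos hx (n+1)).ne'
  have h1 := hp (2/3) (by norm_num)
  have h2 := hp 1 (by norm_num)
  have h3 := hp (1/3) (by norm_num)
  have h4 := hp (1/6) (by norm_num)
  have h5 := hp (1/2) (by norm_num)
  have h6 := hp (5/6) (by norm_num)
  have hf : ((n.factorial : ℕ) : ℝ) ≠ 0 := by positivity
  have r1 : (n:ℝ) ^ (2/3:ℝ) * (n:ℝ) ^ (1/3:ℝ) = n := by
    rw [← Real.rpow_add hn']; norm_num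
  have r2 : (n:ℝ) ^ (1/6:ℝ) * (n:ℝ) ^ (5/6:ℝ) = n := by
    rw [← Real.rpow_add hn']; norm_num
  have r3 : ((n:ℝ) ^ (1/2:ℝ))^2 = n := by
    rw [← Real.rpow_natCast, ← Real.rpow_mul hn'.le]; norm_num
  have q1 : (n:ℝ) ^ (2/3:ℝ) ≠ 0 := by positivity
  have q2 : (n:ℝ) ^ (1/3:ℝ) ≠ 0 := by positivity
  have q3 : (n:ℝ) ^ (1/6:ℝ) ≠ 0 := by positivity
  have q4 : (n:ℝ) ^ (5/6:ℝ) ≠ 0 := by positivity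
  have q5 : (n:ℝ) ^ (1/2:ℝ) ≠ 0 := by positivity
  unfold Real.GammaSeq U
  simp only [add_zero, poch_zero]
  unfold poch
  rw [Real.rpow_one]
  generalize ∏ j ∈ Finset.range (n+1), ((2/3:ℝ) + j) = x1 at *
  generalize ∏ j ∈ Finset.range (n+1), ((1:ℝ) + j) = x2 at *
  generalize ∏ j ∈ Finset.range (n+1), ((1/3:ℝ) + j) = x3 at *
  generalize ∏ j ∈ Finset.range (n+1), ((1/6:ℝ) + j) = x4 at *
  generalize ∏ j ∈ Finset.range (n+1), ((1/2:ℝ) + j) = x5 at *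
  generalize ∏ j ∈ Finset.range (n+1), ((5/6:ℝ) + j) = x6 at *
  generalize ((n.factorial : ℕ) : ℝ) = f at *
  generalize (n:ℝ) ^ (2/3:ℝ) = y1 at *
  generalize (n:ℝ) ^ (1/3:ℝ) = y2 at *
  generalize (n:ℝ) ^ (1/6:ℝ) = y3 at *
  generalize (n:ℝ) ^ (5/6:ℝ) = y4 at *
  generalize (n:ℝ) ^ (1/2:ℝ) = y5 at *
  have hn0 := hn'.ne'
  calc _ = n * n^2 / (n * n) * (x4*x5^2*x6/(x1*x2^2*x3)) := by field_simp
    _ = (y1*y2) * n^2 / ((y3*y4)*y5^2) * (x4*x5^2*x6/(x1*x2^2*x3)) := by rw [r1, r2, r3]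
    _ = _ := by field_simp

lemma U_lim : Tendsto (fun n : ℕ => U (n+1) 0 * n) atTop (𝓝 LL) := by
  have g := fun s => Real.GammaSeq_tendsto_Gamma s
  have hG : ∀ x : ℝ, 0 < x → Real.Gamma x ≠ 0 := fun x hx => (Real.Gamma_pos_of_pos hx).ne'
  have h := ((((g (2/3)).mul ((g 1).pow 2)).mul (g (1/3))).div
    (((g (1/6)).mul ((g (1/2)).pow 2)).mul (g (5/6)))
    (by
      have := hG (1/6) (by norm_num)
      have := hG (1/2) (by norm_num)
      have := hG (5/6) (by norm_num)
      positivity))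
  have e : Real.Gamma (2/3) * Real.Gamma 1 ^ 2 * Real.Gamma (1/3) /
      (Real.Gamma (1/6) * Real.Gamma (1/2) ^ 2 * Real.Gamma (5/6)) = LL := by
    have a1 := Real.Gamma_mul_Gamma_one_sub (1/3)
    have a2 := Real.Gamma_mul_Gamma_one_sub (1/6)
    rw [show (1:ℝ) - 1/3 = 2/3 by norm_num, show π * (1/3) = π/3 by ring, Real.sin_pi_div_three] at a1
    rw [show (1:ℝ) - 1/6 = 5/6 by norm_num, show π * (1/6) = π/6 by ring, Real.sin_pi_div_six] at a2
    rw [Real.Gamma_one, Real.Gamma_one_half_eq, Real.sq_sqrt Real.pi_pos.le]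
    rw [show Real.Gamma (2/3) * 1 ^ 2 * Real.Gamma (1/3) = Real.Gamma (1/3) * Real.Gamma (2/3) by ring,
      show Real.Gamma (1/6) * π * Real.Gamma (5/6) = (Real.Gamma (1/6) * Real.Gamma (5/6)) * π by ring, a1, a2]
    unfold LL
    have := Real.pi_pos
    field_simp
  rw [e] at h
  refine h.congr' ?_
  filter_upwards [eventually_ne_atTop 0] with n hn
  exact (U_zero_succ n hn).symm

lemma Fb_lim_zero : Tendsto (fun n : ℕ => Fb (n+1) 0) atTop (𝓝 LL) := by
  have h1 : Tendsto (fun n : ℕ => 1 + (7/6) * (1/(n:ℝ))) atTop (𝓝 (1 + (7/6)*0)) :=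
    tendsto_const_nhds.add (tendsto_const_nhds.mul tendsto_one_div_atTop_nhds_zero_nat)
  have := U_lim.mul h1
  rw [mul_zero, add_zero, mul_one] at this
  refine this.congr' ?_
  filter_upwards [eventually_ne_atTop 0] with n hn
  have : (n:ℝ) ≠ 0 := by positivity
  unfold Fb
  push_cast
  field_simp
  ring

lemma Fb_lim_succ (k : ℕ) : Tendsto (fun n : ℕ => Fb (n+1) (k+1)) atTop (𝓝 0) := by
  have hstep : ∀ k : ℕ, ∀ a : ℝ, Tendsto (fun n : ℕ => Fb (n+1) k) atTop (𝓝 a) →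
      Tendsto (fun n : ℕ => Fb (n+1) (k+1)) atTop (𝓝 0) := by
    intro k a h
    have h2 : Tendsto (fun n : ℕ => 13 * ((k:ℝ)+1) * (1/(((n+1 : ℕ):ℝ)+1))) atTop (𝓝 (13 * ((k:ℝ)+1) * 0)) :=
      tendsto_const_nhds.mul ((tendsto_add_atTop_iff_nat
        (f := fun n : ℕ => 1/((n:ℝ)+1)) 1).2 tendsto_one_div_add_atTop_nhds_zero_nat)
    have h3 := h.mul h2
    rw [mul_zero, mul_zero] at h3
    exact squeeze_zero (fun n => (Fb_pos _ _).le) (fun n => Fb_ratio (n+1) k) h3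
  induction k with
  | zero => exact hstep 0 _ Fb_lim_zero
  | succ k ih => exact hstep (k+1) _ ih

lemma part_le (K : ℕ) : ∑ k ∈ Finset.range K, Fb 0 k ≤ LL := by
  have h1 : ∑ k ∈ Finset.range K, Fb 0 k ≤ ∑ k ∈ Finset.range (K+1), Fb 0 k := by
    rw [Finset.sum_range_succ]; linarith [Fb_pos 0 K]
  refine h1.trans ?_
  have : Tendsto (fun n : ℕ => ∑ k ∈ Finset.range (K+1), Fb (n+1) k) atTop (𝓝 LL) := by
    have : Tendsto (fun n : ℕ => ∑ k ∈ Finset.range K, Fb (n+1) (k+1) + Fb (n+1) 0) atTop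
        (𝓝 (∑ k ∈ Finset.range K, 0 + LL)) :=
      (tendsto_finsetSum _ fun k _ => Fb_lim_succ k).add Fb_lim_zero
    rw [Finset.sum_const_zero, zero_add] at this
    refine this.congr fun n => ?_
    rw [Finset.sum_range_succ']
  exact ge_of_tendsto' this fun n => Fb_part_mono (n+1) (K+1)

lemma F_hasSum : HasSum (F 0) LL := by
  have hs : Summable (Fb 0) := summable_of_sum_range_le (fun k => (Fb_pos 0 k).le) part_le
  have h1 : ∑' k, Fb 0 k ≤ LL := hs.tsum_le_of_sum_range_le part_le
  have h2 : LL ≤ ∑' k, Fb 0 k := by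
    refine le_of_tendsto' Fb_lim_zero fun n => ?_
    exact le_hasSum (Fb_sum_const hs.hasSum (n+1)) 0 fun k _ => (Fb_pos _ k).le
  have := hs.hasSum
  rw [le_antisymm h1 h2] at this
  rwa [show Fb 0 = F 0 from funext Fb_zero] at this

lemma F_le (n k : ℕ) : F n k ≤ (1/2)^n * F 0 k := by
  induction n with
  | zero => simp
  | succ n ih =>
    refine (F_half n k).trans ?_
    rw [pow_succ]
    linarith

lemma F_summable (n : ℕ) : Summable (F n) :=
  Summable.of_nonneg_of_le (fun k => (F_pos n k).le) (F_le n) (F_hasSum.summable.mul_left _)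

lemma G_step (n : ℕ) : G n 0 = ∑' k, F n k - ∑' k, F (n+1) k := by
  have h1 := (F_summable n).hasSum.tendsto_sum_nat
  have h2 := (F_summable (n+1)).hasSum.tendsto_sum_nat
  have h3 := h1.add ((G_tendsto n).sub_const (G n 0))
  have h4 := tendsto_nhds_unique h2 (h3.congr fun K => (sum_wz (F n) (F (n+1)) (G n) (wz1 n) K).symm)
  linarith

lemma G_hasSum : HasSum (fun n => G n 0) LL := by
  rw [hasSum_iff_tendsto_nat_of_nonneg]
  · have h : ∀ N, ∑ n ∈ Finset.range N, G n 0 = LL - ∑' k, F N k := by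
      intro N
      induction N with
      | zero => simp [F_hasSum.tsum_eq]
      | succ N ih => rw [Finset.sum_range_succ, ih, G_step]; ring
    have h0 : Tendsto (fun N => ∑' k, F N k) atTop (𝓝 0) := by
      have : Tendsto (fun N : ℕ => (1/2:ℝ)^N * LL) atTop (𝓝 (0 * LL)) :=
        (tendsto_pow_atTop_nhds_zero_of_lt_one (by norm_num) (by norm_num)).mul_const _
      rw [zero_mul] at this
      refine squeeze_zero (fun N => tsum_nonneg fun k => (F_pos N k).le) (fun N => ?_) this
      exact hasSum_le (F_le N) (F_summable N).hasSum (F_hasSum.mul_left _)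
    have := h0.const_sub LL
    rw [sub_zero] at this
    exact this.congr fun N => (h N).symm
  · intro n
    refine mul_nonneg (V_pos n 0).le ?_
    unfold Q; positivity

lemma poch_five_thirds (n : ℕ) : poch (5/3) n = poch (2/3) n * (2/3 + n) / (2/3) := by
  induction n with
  | zero => simp [poch_zero]
  | succ n ih => rw [poch_succ, poch_succ, ih]; push_cast; ring

lemma term_eq (n : ℕ) : (1 / 16 ^ n) *
      (poch (1/2) n * poch (5/6) n ^ 2 * poch (5/12) n * poch (11/12) n /
        (poch 1 n ^ 3 * poch (2/3) n * poch (5/3) n)) *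
      (1080 * (n : ℝ) ^ 2 + 798 * n + 55) = 384 * G n 0 := by
  have hq : Q n (0:ℕ) / ((2*n+1+(0:ℕ))^2 * (1/3+2*n) * (4/3+2*n)) =
      (1080 * (n : ℝ) ^ 2 + 798 * n + 55) / (576 * (2/3+n)) := by
    rw [div_eq_div_iff (by positivity) (by positivity)]
    unfold Q
    push_cast
    ring
  unfold G
  rw [hq]
  unfold V
  rw [add_zero, add_zero, poch_double, poch_double, poch_double, poch_five_thirds, poch_zero,
    show (5/6:ℝ)/2 = 5/12 by norm_num, show ((5/6:ℝ)+1)/2 = 11/12 by norm_num,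
    show (1/3:ℝ)/2 = 1/6 by norm_num, show ((1/3:ℝ)+1)/2 = 2/3 by norm_num,
    show ((1:ℝ)+1)/2 = 1 by norm_num, show (16:ℝ)^n = (4^n)^2 by rw [← pow_mul, mul_comm, pow_mul]; norm_num]
  have h1 := (poch_pos (x := 1/6) (by norm_num) n).ne'
  have h2 := (poch_pos (x := 1/2) (by norm_num) n).ne'
  have h3 := (poch_pos (x := 2/3) (by norm_num) n).ne'
  have h4 := (poch_pos (x := 1) (by norm_num) n).ne'
  have h5 : (2/3:ℝ) + n ≠ 0 := by positivity
  have h6 : (4:ℝ)^n ≠ 0 := by positivity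
  generalize poch (1/6) n = x1 at *
  generalize poch (1/2) n = x2 at *
  generalize poch (2/3) n = x3 at *
  generalize poch 1 n = x4 at *
  generalize (4:ℝ)^n = f at *
  generalize poch (5/6) n = x5 at *
  generalize poch (5/12) n = x6 at *
  generalize poch (11/12) n = x7 at *
  generalize (1080 * (n : ℝ) ^ 2 + 798 * n + 55) = z at *
  generalize (2/3:ℝ) + n = y at *
  field_simp
  ring

theorem series_384_div_pi_sqrt3 :
    (384 : ℝ) / (π * Real.sqrt 3) = ∑' n : ℕ, (1 / 16 ^ n) *
      (poch (1/2) n * poch (5/6) n ^ 2 * poch (5/12) n * poch (11/12) n /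
        (poch 1 n ^ 3 * poch (2/3) n * poch (5/3) n)) *
      (1080 * (n : ℝ) ^ 2 + 798 * n + 55) := by
  simp_rw [term_eq]
  rw [(G_hasSum.mul_left 384).tsum_eq, LL, mul_one_div]
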